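/- Let X be a Banach space and 1 ≤ p < ∞ be such that the two-sided inequality E sup_{m≥1} ‖Σ_{n=1}^m d_n‖^p ≍ E ‖(d_n)_{n=1}^∞‖_{γ(ℓ²,X)}^p holds (with constants independent of the martingale) for every X-valued martingale difference sequence (d_n)_{n≥1}. Then X is a UMD Banach space. -/

import Mathlib

open MeasureTheory ProbabilityTheory Filter
open scoped ENNReal NNReal Topology RealInnerProductSpace Classical

noncomputable section

/-- The law of `N` i.i.d. standard Gaussian random variables. -/
def gaussianPi (N : ℕ) : Measure (Fin N → ℝ) :=
  Measure.pi fun _ => gaussianReal 0 1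

/-- The `γ(ℓ²,X)`-norm of a sequence `(d_n)` in a Banach space `X`:
`(E_γ ‖Σ_n γ_n d_n‖²)^{1/2}` with `(γ_n)` i.i.d. standard Gaussians. -/
noncomputable def gammaSeqNorm {X : Type*} [NormedAddCommGroup X] [NormedSpace ℝ X]
    (d : ℕ → X) : ℝ≥0∞ :=
  ⨆ N : ℕ, (∫⁻ g : Fin N → ℝ, (‖∑ i : Fin N, g i • d i‖₊ : ℝ≥0∞) ^ 2 ∂ gaussianPi N) ^ (1 / 2 : ℝ)

/-- `(d_n)` is an `X`-valued martingale difference sequence w.r.t. the filtration `ℱ`,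
i.e. the partial sums `f_m = Σ_{n<m} d_n` form a martingale. -/
def IsMartDiffSeq {Ω X : Type*} [NormedAddCommGroup X] [NormedSpace ℝ X] [CompleteSpace X]
    {m : MeasurableSpace Ω} (ℱ : Filtration ℕ m) (P : Measure Ω) (d : ℕ → Ω → X) : Prop :=
  Martingale (fun n ω => ∑ j ∈ Finset.range n, d j ω) ℱ P

/-- `X` is a UMD Banach space: for all `p ∈ (1,∞)` there is `β > 0` such that for every
martingale difference sequence `(d_j)` and every choice of signs `(ε_j)`,
`(E‖Σ_{j<n} ε_j d_j‖^p)^{1/p} ≤ β (E‖Σ_{j<n} d_j‖^p)^{1/p}`. -/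
def IsUMD (X : Type*) [NormedAddCommGroup X] [NormedSpace ℝ X] [CompleteSpace X] : Prop :=
  ∀ p : ℝ, 1 < p → ∃ β : ℝ, 0 < β ∧
    ∀ (Ω : Type) (m : MeasurableSpace Ω) (P : Measure Ω), IsProbabilityMeasure P →
      ∀ (ℱ : Filtration ℕ m) (d : ℕ → Ω → X), IsMartDiffSeq ℱ P d →
        ∀ ε : ℕ → ℝ, (∀ j, ε j = 1 ∨ ε j = -1) →
          ∀ n : ℕ,
            (∫⁻ ω, (‖∑ j ∈ Finset.range n, ε j • d j ω‖₊ : ℝ≥0∞) ^ p ∂P) ^ (1 / p) ≤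
              ENNReal.ofReal β * (∫⁻ ω, (‖∑ j ∈ Finset.range n, d j ω‖₊ : ℝ≥0∞) ^ p ∂P) ^ (1 / p)

section Pathwise

variable {X : Type*} [NormedAddCommGroup X]

/-- The maximal norm of the first `N` partial sums of `d`. -/
def maxPartialSum (d : ℕ → X) (N : ℕ) : ℝ≥0 :=
  (Finset.range (N + 1)).sup fun k => ‖∑ j ∈ Finset.range k, d j‖₊

lemma nnnorm_sum_le_maxPartialSum (d : ℕ → X) {k N : ℕ} (hk : k ≤ N) :
    ‖∑ j ∈ Finset.range k, d j‖₊ ≤ maxPartialSum d N :=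
  Finset.le_sup (f := fun k => ‖∑ j ∈ Finset.range k, d j‖₊)
    (Finset.mem_range.2 (Nat.lt_succ_of_le hk))

lemma maxPartialSum_le_iff {d : ℕ → X} {N : ℕ} {c : ℝ≥0} :
    maxPartialSum d N ≤ c ↔ ∀ k ≤ N, ‖∑ j ∈ Finset.range k, d j‖₊ ≤ c := by
  simp [maxPartialSum]

lemma maxPartialSum_mono (d : ℕ → X) : Monotone (maxPartialSum d) := fun _ _ h =>
  maxPartialSum_le_iff.2 fun _ hk => nnnorm_sum_le_maxPartialSum d (hk.trans h)

lemma nnnorm_le_two_mul_maxPartialSum (d : ℕ → X) {i N : ℕ} (hi : i < N) :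
    ‖d i‖₊ ≤ 2 * maxPartialSum d N := by
  have h : d i = ∑ j ∈ Finset.range (i + 1), d j - ∑ j ∈ Finset.range i, d j := by
    rw [Finset.sum_range_succ]; abel
  rw [h, two_mul]
  exact (nnnorm_sub_le _ _).trans (add_le_add (nnnorm_sum_le_maxPartialSum d hi)
    (nnnorm_sum_le_maxPartialSum d hi.le))

lemma maxPartialSum_add_le (a b : ℕ → X) (N : ℕ) :
    maxPartialSum (fun n => a n + b n) N ≤ maxPartialSum a N + maxPartialSum b N := by
  refine maxPartialSum_le_iff.2 fun k hk => ?_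
  rw [Finset.sum_add_distrib]
  exact (nnnorm_add_le _ _).trans (add_le_add (nnnorm_sum_le_maxPartialSum a hk)
    (nnnorm_sum_le_maxPartialSum b hk))

lemma maxPartialSum_le_sum (a : ℕ → X) (N : ℕ) :
    maxPartialSum a N ≤ ∑ n ∈ Finset.range N, ‖a n‖₊ := by
  refine maxPartialSum_le_iff.2 fun k hk => (nnnorm_sum_le _ _).trans ?_
  exact Finset.sum_le_sum_of_subset (Finset.range_mono hk)

lemma iSup_enorm_sum_truncated (d : ℕ → X) (N : ℕ) :
    ⨆ M : ℕ, (‖∑ n ∈ Finset.range M, if n < N then d n else 0‖₊ : ℝ≥0∞) = maxPartialSum d N := by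
  have key : ∀ M, ∑ n ∈ Finset.range M, (if n < N then d n else 0) =
      ∑ n ∈ Finset.range (min M N), d n := fun M => by
    rw [← Finset.sum_filter]
    congr 1
    ext n
    simp
  simp_rw [key]
  apply le_antisymm
  · exact iSup_le fun M => ENNReal.coe_le_coe.2
      (nnnorm_sum_le_maxPartialSum d (min_le_right _ _))
  · obtain ⟨k, hk, hk'⟩ := Finset.exists_mem_eq_sup (Finset.range (N + 1)) (by simp)
      fun k => ‖∑ j ∈ Finset.range k, d j‖₊
    refine le_iSup_of_le k ?_
    rw [maxPartialSum, hk', min_eq_left (Nat.lt_succ_iff.1 (Finset.mem_range.1 hk))]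

/-- Partial sums of a stopped sequence of increments are stopped partial sums. -/
lemma exists_sum_indicator_eq {Ω : Type*} (a : ℕ → Ω → X) {B : ℕ → Set Ω} (hB : Antitone B)
    (ω : Ω) (k : ℕ) : ∃ j ≤ k, ∑ n ∈ Finset.range k, (B n).indicator (a n) ω =
      ∑ n ∈ Finset.range j, a n ω ∧ ∀ n < j, ω ∈ B n := by
  induction k with
  | zero => exact ⟨0, le_rfl, by simp⟩
  | succ k ih =>
    by_cases hk : ω ∈ B k
    · have hn : ∀ n < k + 1, ω ∈ B n := fun n hn => hB (Nat.lt_succ_iff.1 hn) hk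
      exact ⟨k + 1, le_rfl, Finset.sum_congr rfl fun n h =>
        Set.indicator_of_mem (hn n (Finset.mem_range.1 h)) _, hn⟩
    · obtain ⟨j, hj, h1, h2⟩ := ih
      refine ⟨j, hj.trans k.le_succ, ?_, h2⟩
      rw [Finset.sum_range_succ, h1, Set.indicator_of_notMem hk, add_zero]

lemma antitone_sublevel_maxPartialSum {Ω : Type*} (d : ℕ → Ω → X) (l : ℝ≥0) :
    Antitone fun n => {ω | maxPartialSum (fun j => d j ω) n ≤ l} :=
  fun _ _ h _ hω => (maxPartialSum_mono _ h).trans hω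

/-- Splitting a sequence of increments along decreasing sets and their complements. -/
lemma sum_indicator_add_sum_indicator_compl {Ω : Type*} (a : ℕ → Ω → X) (B : ℕ → Set Ω) (ω : Ω)
    (k : ℕ) : ∑ n ∈ Finset.range k, (B n).indicator (a n) ω +
      ∑ n ∈ Finset.range k, ((B n)ᶜ).indicator (a n) ω = ∑ n ∈ Finset.range k, a n ω := by
  rw [← Finset.sum_add_distrib]
  exact Finset.sum_congr rfl fun n _ => congrFun (Set.indicator_self_add_compl (B n) (a n)) ω

end Pathwise

lemma nnnorm_sign_smul {X : Type*} [NormedAddCommGroup X] [NormedSpace ℝ X] {e : ℝ}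
    (he : e = 1 ∨ e = -1) (x : X) : ‖e • x‖₊ = ‖x‖₊ := by
  rcases he with rfl | rfl <;> simp

lemma measurePreserving_sign_mul {e : ℝ} (he : e = 1 ∨ e = -1) :
    MeasurePreserving (fun x : ℝ => e * x) (gaussianReal 0 1) (gaussianReal 0 1) := by
  refine ⟨by fun_prop, ?_⟩
  rw [gaussianReal_map_const_mul]
  congr 1
  · simp
  · ext; rcases he with rfl | rfl <;> simp

/-- Symmetric Gaussians make the `γ`-norm invariant under changes of signs. -/
lemma gammaSeqNorm_sign_smul {X : Type*} [NormedAddCommGroup X] [NormedSpace ℝ X] {ε : ℕ → ℝ}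
    (hε : ∀ j, ε j = 1 ∨ ε j = -1) (d : ℕ → X) :
    gammaSeqNorm (fun n => ε n • d n) = gammaSeqNorm d := by
  unfold gammaSeqNorm
  congr 1
  ext N
  congr 1
  have hmp : MeasurePreserving (fun (g : Fin N → ℝ) (i : Fin N) => ε i * g i)
      (gaussianPi N) (gaussianPi N) :=
    measurePreserving_pi _ _ fun i => measurePreserving_sign_mul (hε i)
  have hm : Measurable fun g : Fin N → ℝ =>
      (‖∑ i : Fin N, g i • d i‖₊ : ℝ≥0∞) ^ 2 := by
    have : Continuous fun g : Fin N → ℝ => ‖∑ i : Fin N, g i • d i‖₊ := by fun_prop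
    exact this.measurable.coe_nnreal_ennreal.pow_const 2
  rw [← hmp.lintegral_comp hm]
  refine lintegral_congr fun g => ?_
  simp [smul_smul, mul_comm]

section MartingaleDifferences

lemma measurable_finset_sup_nnreal {Ω ι : Type*} {m : MeasurableSpace Ω} {s : Finset ι}
    {f : ι → Ω → ℝ≥0} (hf : ∀ k ∈ s, Measurable (f k)) :
    Measurable (fun ω => s.sup fun k => f k ω) := by
  have : (fun ω => s.sup fun k => f k ω) = s.sup f := by
    ext ω; simp [Finset.sup_apply]
  rw [this]
  exact Finset.sup_induction measurable_const (fun _ hf _ hg => hf.sup hg) hf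

variable {Ω X : Type*} [NormedAddCommGroup X] [NormedSpace ℝ X]
  {m : MeasurableSpace Ω} {ℱ : Filtration ℕ m} {P : Measure Ω}

/-- The increment-wise description of martingale difference sequences. -/
structure IsIncrementSeq (ℱ : Filtration ℕ m) (P : Measure Ω) (d : ℕ → Ω → X) : Prop where
  stronglyMeasurable : ∀ n, StronglyMeasurable[ℱ (n + 1)] (d n)
  integrable : ∀ n, Integrable (d n) P
  condExp_eq_zero : ∀ n, P[d n | ℱ n] =ᵐ[P] 0

namespace IsIncrementSeq

variable {d : ℕ → Ω → X}

lemma stronglyMeasurable_of_lt (hd : IsIncrementSeq ℱ P d) {i n : ℕ} (h : i < n) :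
    StronglyMeasurable[ℱ n] (d i) := (hd.stronglyMeasurable i).mono (ℱ.mono h)

lemma stronglyMeasurable_sum (hd : IsIncrementSeq ℱ P d) {k n : ℕ} (h : k ≤ n) :
    StronglyMeasurable[ℱ n] (fun ω => ∑ j ∈ Finset.range k, d j ω) :=
  Finset.stronglyMeasurable_fun_sum _ fun _ hj =>
    hd.stronglyMeasurable_of_lt ((Finset.mem_range.1 hj).trans_le h)

lemma integrable_sum (hd : IsIncrementSeq ℱ P d) (k : ℕ) :
    Integrable (fun ω => ∑ j ∈ Finset.range k, d j ω) P :=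
  integrable_finsetSum _ fun _ _ => hd.integrable _

lemma measurable_maxPartialSum (hd : IsIncrementSeq ℱ P d) (n : ℕ) :
    Measurable[ℱ n] (fun ω => maxPartialSum (fun j => d j ω) n) :=
  measurable_finset_sup_nnreal fun _ hk => (hd.stronglyMeasurable_sum
    (Nat.lt_succ_iff.1 (Finset.mem_range.1 hk))).nnnorm.measurable

variable [CompleteSpace X]

lemma isMartDiffSeq [IsProbabilityMeasure P] (hd : IsIncrementSeq ℱ P d) :
    IsMartDiffSeq ℱ P d := by
  refine martingale_of_condExp_sub_eq_zero_nat (fun n => hd.stronglyMeasurable_sum le_rfl)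
    hd.integrable_sum fun n => ?_
  have : ((fun ω => ∑ j ∈ Finset.range (n + 1), d j ω) - fun ω => ∑ j ∈ Finset.range n, d j ω)
      = d n := by
    ext ω; simp [Finset.sum_range_succ]
  rw [this]
  exact hd.condExp_eq_zero n

lemma of_isMartDiffSeq [IsProbabilityMeasure P] (hd : IsMartDiffSeq ℱ P d) :
    IsIncrementSeq ℱ P d := by
  have key : ∀ n, d n = (fun ω => ∑ j ∈ Finset.range (n + 1), d j ω) -
      fun ω => ∑ j ∈ Finset.range n, d j ω := fun n => by
    ext ω; simp [Finset.sum_range_succ]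
  refine ⟨fun n => ?_, fun n => ?_, fun n => ?_⟩
  · rw [key n]
    exact (hd.stronglyMeasurable (n + 1)).sub ((hd.stronglyMeasurable n).mono (ℱ.mono n.le_succ))
  · rw [key n]
    exact (hd.integrable (n + 1)).sub (hd.integrable n)
  · rw [key n]
    refine (condExp_sub (hd.integrable (n + 1)) (hd.integrable n) (ℱ n)).trans ?_
    filter_upwards [hd.2 n (n + 1) n.le_succ, hd.2 n n le_rfl] with ω h1 h2
    rw [Pi.sub_apply, h1, h2, sub_self, Pi.zero_apply]

lemma const_smul (hd : IsIncrementSeq ℱ P d) (ε : ℕ → ℝ) :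
    IsIncrementSeq ℱ P (fun n ω => ε n • d n ω) := by
  refine ⟨fun n => (hd.stronglyMeasurable n).const_smul (ε n),
    fun n => (hd.integrable n).smul (ε n), fun n => ?_⟩
  refine (condExp_smul (ε n) (d n) (ℱ n)).trans ?_
  filter_upwards [hd.condExp_eq_zero n] with ω h
  simp [h]

lemma indicator (hd : IsIncrementSeq ℱ P d) {B : ℕ → Set Ω}
    (hB : ∀ n, MeasurableSet[ℱ n] (B n)) :
    IsIncrementSeq ℱ P (fun n => (B n).indicator (d n)) := by
  refine ⟨fun n => (hd.stronglyMeasurable n).indicator (ℱ.mono n.le_succ _ (hB n)),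
    fun n => (hd.integrable n).indicator (ℱ.le n _ (hB n)), fun n => ?_⟩
  refine (condExp_indicator (hd.integrable n) (hB n)).trans ?_
  filter_upwards [hd.condExp_eq_zero n] with ω h
  by_cases hω : ω ∈ B n <;> simp [hω, h]

end IsIncrementSeq

end MartingaleDifferences

/-- Sign changes are bounded for the maximal function of martingales in `L^p`. -/
def MaximalSignBound (X : Type*) [NormedAddCommGroup X] [NormedSpace ℝ X] [CompleteSpace X]
    (p : ℝ) (K : ℝ≥0) : Prop :=
  ∀ (Ω : Type) (m : MeasurableSpace Ω) (P : Measure Ω), IsProbabilityMeasure P →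
    ∀ (ℱ : Filtration ℕ m) (d : ℕ → Ω → X), IsIncrementSeq ℱ P d →
      ∀ ε : ℕ → ℝ, (∀ j, ε j = 1 ∨ ε j = -1) → ∀ N : ℕ,
        ∫⁻ ω, (maxPartialSum (fun n => ε n • d n ω) N : ℝ≥0∞) ^ p ∂P ≤
          K * ∫⁻ ω, (maxPartialSum (fun n => d n ω) N : ℝ≥0∞) ^ p ∂P

lemma maximalSignBound_of_bdg
    (X : Type*) [NormedAddCommGroup X] [NormedSpace ℝ X] [CompleteSpace X]
    (p : ℝ) (c C : ℝ) (hc : 0 < c)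
    (h : ∀ (Ω : Type) (m : MeasurableSpace Ω) (P : Measure Ω), IsProbabilityMeasure P →
      ∀ (ℱ : Filtration ℕ m) (d : ℕ → Ω → X), IsMartDiffSeq ℱ P d →
        ENNReal.ofReal c * ∫⁻ ω, gammaSeqNorm (fun n => d n ω) ^ p ∂P ≤
            ∫⁻ ω, (⨆ M : ℕ, (‖∑ n ∈ Finset.range M, d n ω‖₊ : ℝ≥0∞)) ^ p ∂P ∧
        (∫⁻ ω, (⨆ M : ℕ, (‖∑ n ∈ Finset.range M, d n ω‖₊ : ℝ≥0∞)) ^ p ∂P) ≤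
            ENNReal.ofReal C * ∫⁻ ω, gammaSeqNorm (fun n => d n ω) ^ p ∂P) :
    MaximalSignBound X p (C.toNNReal * (c.toNNReal)⁻¹) := by
  intro Ω m P hP ℱ d hd ε hε N
  have hT : IsIncrementSeq ℱ P (fun n ω => if n < N then d n ω else 0) := by
    have := hd.indicator (B := fun n => if n < N then Set.univ else ∅)
      (fun n => by split_ifs <;> simp)
    convert this using 2 with n
    ext ω
    split_ifs <;> simp
  have h1 := (h Ω m P hP ℱ _ (hT.const_smul ε).isMartDiffSeq).2
  have h2 := (h Ω m P hP ℱ _ hT.isMartDiffSeq).1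
  simp_rw [gammaSeqNorm_sign_smul hε] at h1
  have e1 : ∀ n ω, (ε n • if n < N then d n ω else 0) = if n < N then ε n • d n ω else 0 := by
    intro n ω; split_ifs <;> simp
  simp_rw [e1] at h1
  simp_rw [iSup_enorm_sum_truncated (fun n => ε n • d n _) N] at h1
  simp_rw [iSup_enorm_sum_truncated (fun n => d n _) N] at h2
  have hc0 : c.toNNReal ≠ 0 := by simpa using hc
  refine h1.trans ?_
  rw [ENNReal.coe_mul, mul_assoc]
  refine mul_le_mul_right ?_ _
  rw [ENNReal.coe_inv hc0, ← ENNReal.div_eq_inv_mul, ENNReal.le_div_iff_mul_le (by simp [hc])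
    (by simp), mul_comm]
  exact h2

section Integration

lemma rpow_young (A y x : ℝ≥0) {q : ℝ} (hq : 1 < q) :
    A * (y * x ^ (q - 1)) ≤ x ^ q / 2 + (2 * A * y) ^ q := by
  have hpow : ∀ z : ℝ≥0, z * z ^ (q - 1) = z ^ q := fun z => by
    rcases eq_or_ne z 0 with rfl | hz
    · rw [NNReal.zero_rpow (by linarith : q ≠ 0), zero_mul]
    · rw [NNReal.rpow_sub_one hz, mul_div_cancel₀ _ hz]
  have hq1 : 0 ≤ q - 1 := by linarith
  rcases le_total (2 * A * y) x with h | h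
  · refine le_add_right ?_
    rw [le_div_iff₀ two_pos, ← hpow x]
    calc A * (y * x ^ (q - 1)) * 2 = (2 * A * y) * x ^ (q - 1) := by ring
      _ ≤ _ := by gcongr
  · refine le_add_left ?_
    rw [← hpow (2 * A * y)]
    calc A * (y * x ^ (q - 1)) = (A * y) * x ^ (q - 1) := by ring
      _ ≤ (2 * A * y) * (2 * A * y) ^ (q - 1) := by
        gcongr
        rw [two_mul]
        exact le_add_right le_rfl

lemma lintegral_coe_rpow_eq_lintegral_meas_lt {Ω : Type*} [MeasurableSpace Ω] (μ : Measure Ω)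
    {f : Ω → ℝ≥0} (hf : Measurable f) {q : ℝ} (hq : 0 < q) :
    ∫⁻ ω, (f ω : ℝ≥0∞) ^ q ∂μ = ENNReal.ofReal q *
      ∫⁻ t in Set.Ioi (0 : ℝ), μ {ω | t < f ω} * ENNReal.ofReal (t ^ (q - 1)) := by
  rw [← lintegral_rpow_eq_lintegral_meas_lt_mul μ (ae_of_all _ fun ω => (f ω).coe_nonneg)
    hf.coe_nnreal_real.aemeasurable hq]
  refine lintegral_congr fun ω => ?_
  rw [← ENNReal.ofReal_rpow_of_nonneg (f ω).coe_nonneg hq.le, ENNReal.ofReal_coe_nnreal]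

lemma lintegral_rpow_le_of_weak_of_bounded {Ω : Type*} [MeasurableSpace Ω] {P : Measure Ω}
    [IsProbabilityMeasure P] {M Y : Ω → ℝ≥0} (hM : Measurable M) (hY : Measurable Y) {q : ℝ}
    (hq : 1 < q) (C : ℝ≥0) (hb : ∃ b : ℝ≥0, ∀ ω, M ω ≤ b)
    (hw : ∀ l : ℝ≥0, 0 < l →
      l * P {ω | 2 * l < M ω} ≤ C * ∫⁻ ω in {ω | l < M ω}, Y ω ∂P) :
    ∫⁻ ω, (M ω : ℝ≥0∞) ^ q ∂P ≤ ((2 * (2 * (q.toNNReal * (2 * C) * ((q - 1).toNNReal)⁻¹ *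
      2 ^ (q - 1))) ^ q : ℝ≥0) : ℝ≥0∞) * ∫⁻ ω, (Y ω : ℝ≥0∞) ^ q ∂P := by
  set A : ℝ≥0 := q.toNNReal * (2 * C) * ((q - 1).toNNReal)⁻¹ * 2 ^ (q - 1) with hA
  have hq0 : 0 < q := by linarith
  have hq1 : 0 < q - 1 := by linarith
  set ν := P.withDensity (fun ω => (Y ω : ℝ≥0∞)) with hν
  have hν' : ∀ t : ℝ, 0 < t → P {ω | t < M ω} * ENNReal.ofReal (t ^ (q - 1)) ≤
      2 * C * (ν {ω | t < (2 * M ω : ℝ≥0)} * ENNReal.ofReal (t ^ (q - 1 - 1))) := by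
    intro t ht
    have h1 := hw (t / 2).toNNReal (by simpa using ht)
    have s1 : {ω | 2 * (t / 2).toNNReal < M ω} = {ω | t < M ω} := by
      ext ω
      simp only [Set.mem_ofPred_eq]
      rw [← NNReal.coe_lt_coe, NNReal.coe_mul, Real.coe_toNNReal _ (by positivity)]
      simp [mul_div_cancel₀]
    have s2 : {ω | (t / 2).toNNReal < M ω} = {ω | t < (2 * M ω : ℝ≥0)} := by
      ext ω
      simp only [Set.mem_ofPred_eq]
      rw [← NNReal.coe_lt_coe, NNReal.coe_mul, Real.coe_toNNReal _ (by positivity),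
        div_lt_iff₀ two_pos, mul_comm]
      simp
    rw [s1, s2, ← withDensity_apply _ (measurableSet_lt measurable_const (by fun_prop)), ← hν]
      at h1
    have e1 : ENNReal.ofReal (t ^ (q - 1)) =
        2 * (((t / 2).toNNReal : ℝ≥0) : ℝ≥0∞) * ENNReal.ofReal (t ^ (q - 1 - 1)) := by
      have : (2 : ℝ≥0∞) = ENNReal.ofReal 2 := by simp
      rw [this]
      change _ = ENNReal.ofReal 2 * ENNReal.ofReal (t / 2) * _
      rw [← ENNReal.ofReal_mul two_pos.le, ← ENNReal.ofReal_mul (by positivity)]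
      congr 1
      rw [Real.rpow_sub_one ht.ne' (q - 1)]
      field_simp
    rw [e1]
    calc P {ω | t < M ω} * (2 * ((t / 2).toNNReal : ℝ≥0∞) * ENNReal.ofReal (t ^ (q - 1 - 1)))
        = 2 * (((t / 2).toNNReal : ℝ≥0∞) * P {ω | t < M ω}) *
          ENNReal.ofReal (t ^ (q - 1 - 1)) := by ring
      _ ≤ 2 * (C * ν {ω | t < (2 * M ω : ℝ≥0)}) * ENNReal.ofReal (t ^ (q - 1 - 1)) := by gcongr
      _ = _ := by ring
  have hq1' : (q - 1).toNNReal ≠ 0 := by simpa using hq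
  have main : ∫⁻ ω, (M ω : ℝ≥0∞) ^ q ∂P ≤
      ∫⁻ ω, ((A * (Y ω * M ω ^ (q - 1)) : ℝ≥0) : ℝ≥0∞) ∂P := by
    have l2 := lintegral_coe_rpow_eq_lintegral_meas_lt ν (f := fun ω => 2 * M ω)
      (by fun_prop) hq1
    rw [lintegral_coe_rpow_eq_lintegral_meas_lt P hM hq0]
    calc _ ≤ ENNReal.ofReal q * ∫⁻ t in Set.Ioi (0 : ℝ), 2 * C *
          (ν {ω | t < (2 * M ω : ℝ≥0)} * ENNReal.ofReal (t ^ (q - 1 - 1))) := by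
          gcongr 1
          exact setLIntegral_mono' measurableSet_Ioi fun t ht => hν' t ht
      _ = ENNReal.ofReal q * (2 * C) * ∫⁻ t in Set.Ioi (0 : ℝ),
          (ν {ω | t < (2 * M ω : ℝ≥0)} * ENNReal.ofReal (t ^ (q - 1 - 1))) := by
          rw [lintegral_const_mul' _ _ (by finiteness), mul_assoc (ENNReal.ofReal q)]
      _ = ENNReal.ofReal q * (2 * C) * ((((q - 1).toNNReal)⁻¹ : ℝ≥0) *
          ∫⁻ ω, ((2 * M ω : ℝ≥0) : ℝ≥0∞) ^ (q - 1) ∂ν) := by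
          rw [l2, ← mul_assoc (((q - 1).toNNReal⁻¹ : ℝ≥0) : ℝ≥0∞)]
          rw [ENNReal.coe_inv hq1', show ENNReal.ofReal (q - 1) = ((q - 1).toNNReal : ℝ≥0∞) from rfl,
            ENNReal.inv_mul_cancel (by simpa using hq) (by simp), one_mul]
      _ = _ := by
          rw [hν, lintegral_withDensity_eq_lintegral_mul _ (by fun_prop) (by fun_prop)]
          rw [← lintegral_const_mul _ (by fun_prop), ← lintegral_const_mul _ (by fun_prop)]
          refine lintegral_congr fun ω => ?_
          rw [Pi.mul_apply, ← ENNReal.coe_rpow_of_nonneg _ hq1.le, NNReal.mul_rpow, hA]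
          simp only [ENNReal.coe_mul, ENNReal.ofReal]
          push_cast
          ring
  have fin : ∫⁻ ω, (M ω : ℝ≥0∞) ^ q ∂P ≠ ∞ := by
    obtain ⟨b, hb⟩ := hb
    refine ne_top_of_le_ne_top (b := ∫⁻ _, (b : ℝ≥0∞) ^ q ∂P) ?_
      (lintegral_mono fun ω => ENNReal.rpow_le_rpow (by exact_mod_cast hb ω) hq0.le)
    simp only [lintegral_const, measure_univ, mul_one]
    finiteness
  set I := ∫⁻ ω, (M ω : ℝ≥0∞) ^ q ∂P with hI
  have split : I ≤ I / 2 + ((2 * A) ^ q : ℝ≥0) * ∫⁻ ω, (Y ω : ℝ≥0∞) ^ q ∂P := by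
    refine main.trans ?_
    rw [hI, ENNReal.div_eq_inv_mul, ← lintegral_const_mul _ (by fun_prop),
      ← lintegral_const_mul _ (by fun_prop), ← lintegral_add_left (by fun_prop)]
    refine lintegral_mono fun ω => ?_
    refine (ENNReal.coe_le_coe.2 (rpow_young A (Y ω) (M ω) hq)).trans (le_of_eq ?_)
    rw [NNReal.mul_rpow, ENNReal.coe_add, ENNReal.coe_div two_ne_zero, ENNReal.coe_mul,
      ← ENNReal.coe_rpow_of_nonneg _ hq0.le, ← ENNReal.coe_rpow_of_nonneg _ hq0.le,
      ENNReal.div_eq_inv_mul]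
    rfl
  have h2 : I / 2 ≤ ((2 * A) ^ q : ℝ≥0) * ∫⁻ ω, (Y ω : ℝ≥0∞) ^ q ∂P := by
    have hne : I / 2 ≠ ∞ := ENNReal.div_ne_top fin two_ne_zero
    nth_rw 1 [← ENNReal.add_halves I] at split
    exact (ENNReal.add_le_add_iff_left hne).1 split
  rw [ENNReal.div_le_iff two_ne_zero ENNReal.ofNat_ne_top] at h2
  refine h2.trans (le_of_eq ?_)
  push_cast
  ring

/-- A weak-type estimate localised on level sets self-improves to a strong-type estimate. -/
lemma exists_lintegral_rpow_le_of_weak {q : ℝ} (hq : 1 < q) (C : ℝ≥0) :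
    ∃ C' : ℝ≥0, ∀ (Ω : Type) (_ : MeasurableSpace Ω) (P : Measure Ω), IsProbabilityMeasure P →
      ∀ M Y : Ω → ℝ≥0, Measurable M → Measurable Y →
      (∀ l : ℝ≥0, 0 < l → l * P {ω | 2 * l < M ω} ≤ C * ∫⁻ ω in {ω | l < M ω}, Y ω ∂P) →
      ∫⁻ ω, (M ω : ℝ≥0∞) ^ q ∂P ≤ C' * ∫⁻ ω, (Y ω : ℝ≥0∞) ^ q ∂P := by
  refine ⟨2 * (2 * (q.toNNReal * (2 * C) * ((q - 1).toNNReal)⁻¹ * 2 ^ (q - 1))) ^ q,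
    fun Ω _ P hP M Y hM hY hw => ?_⟩
  have hsup : ∀ ω, (M ω : ℝ≥0∞) ^ q = ⨆ k : ℕ, ((min (M ω) k : ℝ≥0) : ℝ≥0∞) ^ q := by
    intro ω
    apply le_antisymm
    · obtain ⟨k, hk⟩ := exists_nat_ge (M ω)
      exact le_iSup_of_le k (by rw [min_eq_left hk])
    · exact iSup_le fun k => ENNReal.rpow_le_rpow
        (ENNReal.coe_le_coe.2 (min_le_left _ _)) (by linarith)
  simp_rw [hsup]
  have hmono : Monotone fun (k : ℕ) ω => ((min (M ω) k : ℝ≥0) : ℝ≥0∞) ^ q :=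
    fun i j hij ω => ENNReal.rpow_le_rpow
      (ENNReal.coe_le_coe.2 (min_le_min le_rfl (by exact_mod_cast hij))) (by linarith)
  rw [lintegral_iSup (fun k => by fun_prop) hmono]
  refine iSup_le fun k => lintegral_rpow_le_of_weak_of_bounded (hM.min measurable_const) hY hq C
    ⟨k, fun ω => min_le_right _ _⟩ fun l hl => ?_
  by_cases hk : l < (k : ℝ≥0)
  · have : {ω | l < min (M ω) (k : ℝ≥0)} = {ω | l < M ω} := by ext ω; simp [hk]
    rw [this]
    refine le_trans ?_ (hw l hl)
    gcongr
    exact min_le_left _ _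
  · have : {ω | 2 * l < min (M ω) (k : ℝ≥0)} = ∅ := by
      ext ω
      simp only [Set.mem_ofPred_eq, Set.mem_empty_iff_false, iff_false, not_lt]
      refine (min_le_right _ _).trans ((not_lt.1 hk).trans ?_)
      rw [two_mul]; exact le_add_right le_rfl
    rw [this]; simp

end Integration

section Doob

variable {Ω X : Type*} [NormedAddCommGroup X] [NormedSpace ℝ X] [CompleteSpace X]
  {m : MeasurableSpace Ω} {ℱ : Filtration ℕ m} {P : Measure Ω} [IsProbabilityMeasure P]
  {d : ℕ → Ω → X}

lemma IsIncrementSeq.submartingale_norm (hd : IsIncrementSeq ℱ P d) :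
    Submartingale (fun n ω => ‖∑ j ∈ Finset.range n, d j ω‖) ℱ P := by
  have hM : Martingale (fun n ω => ∑ j ∈ Finset.range n, d j ω) ℱ P := hd.isMartDiffSeq
  refine ⟨fun n => (hd.stronglyMeasurable_sum le_rfl).norm, fun i j hij => ?_,
    fun n => (hd.integrable_sum n).norm⟩
  filter_upwards [hM.2 i j hij, norm_condExp_le (μ := P) (m := ℱ i)
    (fun ω => ∑ k ∈ Finset.range j, d k ω)] with ω h1 h2
  rw [← h1]
  exact h2

lemma IsIncrementSeq.doob_weak (hd : IsIncrementSeq ℱ P d) (N : ℕ) (l : ℝ≥0) (hl : 0 < l) :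
    l * P {ω | 2 * l < maxPartialSum (fun j => d j ω) N} ≤
      (1 : ℝ≥0) * ∫⁻ ω in {ω | l < maxPartialSum (fun j => d j ω) N},
        ‖∑ j ∈ Finset.range N, d j ω‖₊ ∂P := by
  have h := maximal_ineq hd.submartingale_norm (fun n ω => norm_nonneg _) (ε := 2 * l) N
  set S := {ω | ((2 * l : ℝ≥0) : ℝ) ≤ (Finset.range (N + 1)).sup' Finset.nonempty_range_add_one
    fun k => ‖∑ j ∈ Finset.range k, d j ω‖}
  have s1 : {ω | 2 * l < maxPartialSum (fun j => d j ω) N} ⊆ S := by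
    intro ω hω
    obtain ⟨k, hk, hk'⟩ := Finset.exists_mem_eq_sup (Finset.range (N + 1)) (by simp)
      fun k => ‖∑ j ∈ Finset.range k, d j ω‖₊
    simp only [Set.mem_ofPred_eq, maxPartialSum, hk'] at hω
    refine le_trans (b := ‖∑ j ∈ Finset.range k, d j ω‖) (NNReal.coe_le_coe.2 hω.le) ?_
    exact Finset.le_sup' (fun k => ‖∑ j ∈ Finset.range k, d j ω‖) hk
  have s2 : S ⊆ {ω | l < maxPartialSum (fun j => d j ω) N} := by
    intro ω hω
    have : ((2 * l : ℝ≥0) : ℝ) ≤ maxPartialSum (fun j => d j ω) N := by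
      refine le_trans hω (Finset.sup'_le _ _ fun k hk => ?_)
      exact NNReal.coe_le_coe.2 (nnnorm_sum_le_maxPartialSum (fun j => d j ω)
        (Nat.lt_succ_iff.1 (Finset.mem_range.1 hk)))
    refine lt_of_lt_of_le ?_ (NNReal.coe_le_coe.1 this)
    rw [two_mul]
    exact lt_add_of_pos_left l hl
  rw [ENNReal.coe_one, one_mul]
  calc (l : ℝ≥0∞) * P {ω | 2 * l < maxPartialSum (fun j => d j ω) N}
      ≤ ((2 * l : ℝ≥0) : ℝ≥0∞) * P S := by
        gcongr
        rw [two_mul]; exact le_add_right le_rfl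
    _ ≤ _ := h
    _ = ∫⁻ ω in S, ‖∑ j ∈ Finset.range N, d j ω‖₊ ∂P := by
        rw [ofReal_integral_eq_lintegral_ofReal (hd.integrable_sum N).norm.integrableOn
          (ae_of_all _ fun ω => norm_nonneg _)]
        refine lintegral_congr fun ω => ?_
        rw [ofReal_norm]; rfl
    _ ≤ _ := lintegral_mono_set s2

end Doob

/-- Doob's maximal inequality in `L^q`. -/
lemma exists_doob_maximal (X : Type*) [NormedAddCommGroup X] [NormedSpace ℝ X] [CompleteSpace X]
    {q : ℝ} (hq : 1 < q) : ∃ K : ℝ≥0,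
    ∀ (Ω : Type) (m : MeasurableSpace Ω) (P : Measure Ω), IsProbabilityMeasure P →
      ∀ (ℱ : Filtration ℕ m) (d : ℕ → Ω → X), IsIncrementSeq ℱ P d → ∀ N : ℕ,
        ∫⁻ ω, (maxPartialSum (fun n => d n ω) N : ℝ≥0∞) ^ q ∂P ≤
          K * ∫⁻ ω, (‖∑ j ∈ Finset.range N, d j ω‖₊ : ℝ≥0∞) ^ q ∂P := by
  obtain ⟨K, hK⟩ := exists_lintegral_rpow_le_of_weak hq 1
  exact ⟨K, fun Ω m P hP ℱ d hd N => hK Ω m P hP _ _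
    ((hd.measurable_maxPartialSum N).mono (ℱ.le N) le_rfl)
    ((hd.stronglyMeasurable_sum le_rfl).nnnorm.measurable.mono (ℱ.le N) le_rfl)
    (hd.doob_weak N)⟩

section ExtrapolationUp

variable {X : Type*} [NormedAddCommGroup X] [NormedSpace ℝ X] [CompleteSpace X]

lemma MaximalSignBound.weak {K : ℝ≥0} (h : MaximalSignBound X 1 K) {Ω : Type}
    {m : MeasurableSpace Ω} {P : Measure Ω} [IsProbabilityMeasure P] {ℱ : Filtration ℕ m}
    {d : ℕ → Ω → X} (hd : IsIncrementSeq ℱ P d) {ε : ℕ → ℝ} (hε : ∀ j, ε j = 1 ∨ ε j = -1)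
    (N : ℕ) (l : ℝ≥0) :
    l * P {ω | 2 * l < maxPartialSum (fun j => ε j • d j ω) N} ≤
      ((2 + 2 * K : ℝ≥0) : ℝ≥0∞) *
        ∫⁻ ω in {ω | l < maxPartialSum (fun j => ε j • d j ω) N},
          maxPartialSum (fun j => d j ω) N ∂P := by
  set e : ℕ → Ω → X := fun n ω => ε n • d n ω with he
  have hde : IsIncrementSeq ℱ P e := hd.const_smul ε
  set M : Ω → ℝ≥0 := fun ω => maxPartialSum (fun j => e j ω) N
  set F : Ω → ℝ≥0 := fun ω => maxPartialSum (fun j => d j ω) N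
  set B : ℕ → Set Ω := fun n => {ω | maxPartialSum (fun j => e j ω) n ≤ l}
  have hBanti : Antitone B := antitone_sublevel_maxPartialSum e l
  have hBm : ∀ n, MeasurableSet[ℱ n] (B n) := fun n =>
    hde.measurable_maxPartialSum n measurableSet_Iic
  have hMm : Measurable M := (hde.measurable_maxPartialSum N).mono (ℱ.le N) le_rfl
  have hFm : Measurable F := (hd.measurable_maxPartialSum N).mono (ℱ.le N) le_rfl
  set u : ℕ → Ω → X := fun n => ((B n)ᶜ).indicator (d n) with hu
  have hdu : IsIncrementSeq ℱ P u := hd.indicator fun n => (hBm n).compl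
  set T : Set Ω := {ω | l < M ω}
  have hTm : MeasurableSet T := measurableSet_lt measurable_const hMm
  have hue : ∀ n ω, ε n • u n ω = ((B n)ᶜ).indicator (e n) ω := fun n ω => by
    by_cases hω : ω ∈ B n <;> simp [hu, he, hω]
  have hbound := h Ω m P inferInstance ℱ u hdu ε hε N
  simp_rw [ENNReal.rpow_one] at hbound
  have hu_le : ∀ ω, (maxPartialSum (fun n => u n ω) N : ℝ≥0∞) ≤
      T.indicator (fun ω => 2 * (F ω : ℝ≥0∞)) ω := by
    intro ω
    by_cases hω : ω ∈ T
    · rw [Set.indicator_of_mem hω, ← ENNReal.coe_ofNat, ← ENNReal.coe_mul, ENNReal.coe_le_coe]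
      refine maxPartialSum_le_iff.2 fun k hk => ?_
      have hsplit := sum_indicator_add_sum_indicator_compl d B ω k
      obtain ⟨j, hj, hj', -⟩ := exists_sum_indicator_eq d hBanti ω k
      rw [hj'] at hsplit
      rw [show ∑ n ∈ Finset.range k, u n ω = _ from eq_sub_iff_add_eq'.2 hsplit, two_mul]
      exact (nnnorm_sub_le _ _).trans (add_le_add
        (nnnorm_sum_le_maxPartialSum (fun j => d j ω) hk)
        (nnnorm_sum_le_maxPartialSum (fun j => d j ω) (hj.trans hk)))
    · rw [Set.indicator_of_notMem hω, nonpos_iff_eq_zero, ENNReal.coe_eq_zero,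
        ← nonpos_iff_eq_zero]
      refine maxPartialSum_le_iff.2 fun k hk => ?_
      rw [Finset.sum_eq_zero, nnnorm_zero]
      intro n hn
      refine Set.indicator_of_notMem ?_ _
      rw [Set.notMem_compl_iff]
      exact hBanti ((Finset.mem_range.1 hn).le.trans hk) (show M ω ≤ l from not_lt.1 hω)
  have hM_le : ∀ ω, M ω ≤ l + 2 * F ω + maxPartialSum (fun n => ε n • u n ω) N := by
    intro ω
    refine maxPartialSum_le_iff.2 fun k hk => ?_
    rw [← sum_indicator_add_sum_indicator_compl e B ω k]
    refine (nnnorm_add_le _ _).trans (add_le_add ?_ ?_)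
    · obtain ⟨j, hj, hj', hjB⟩ := exists_sum_indicator_eq e hBanti ω k
      rw [hj']
      rcases j with - | i
      · simp
      · rw [Finset.sum_range_succ]
        refine (nnnorm_add_le _ _).trans (add_le_add ?_ ?_)
        · exact (nnnorm_sum_le_maxPartialSum (fun j => e j ω) le_rfl).trans
            (hjB i i.lt_succ_self)
        · rw [he, nnnorm_sign_smul (hε i)]
          exact nnnorm_le_two_mul_maxPartialSum (fun j => d j ω) (by omega)
    · simp_rw [← hue]
      exact nnnorm_sum_le_maxPartialSum (fun n => ε n • u n ω) hk
  have step : (l : ℝ≥0∞) * P {ω | 2 * l < M ω} ≤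
      ∫⁻ ω in T, (2 * (F ω : ℝ≥0∞) + maxPartialSum (fun n => ε n • u n ω) N) ∂P := by
    have hsub : {ω | 2 * l < M ω} ⊆ T := fun ω hω =>
      show l < M ω from lt_of_le_of_lt (le_mul_of_one_le_left zero_le one_le_two) hω
    rw [← setLIntegral_const]
    refine le_trans ?_ (lintegral_mono_set hsub)
    refine setLIntegral_mono' (measurableSet_lt measurable_const hMm) fun ω hω => ?_
    have h1 := hω.le.trans (hM_le ω)
    rw [two_mul, add_assoc, add_le_add_iff_left] at h1
    exact_mod_cast h1
  calc (l : ℝ≥0∞) * P {ω | 2 * l < M ω}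
      ≤ ∫⁻ ω in T, (2 * (F ω : ℝ≥0∞) + maxPartialSum (fun n => ε n • u n ω) N) ∂P := step
    _ = ∫⁻ ω in T, 2 * (F ω : ℝ≥0∞) ∂P +
        ∫⁻ ω in T, maxPartialSum (fun n => ε n • u n ω) N ∂P :=
        lintegral_add_left (by fun_prop) _
    _ ≤ ∫⁻ ω in T, 2 * (F ω : ℝ≥0∞) ∂P + K * ∫⁻ ω in T, 2 * (F ω : ℝ≥0∞) ∂P := by
        refine add_le_add le_rfl ((setLIntegral_le_lintegral _ _).trans (hbound.trans ?_))
        refine mul_le_mul_right ?_ _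
        rw [← lintegral_indicator hTm]
        exact lintegral_mono hu_le
    _ = _ := by
        rw [lintegral_const_mul _ (by fun_prop)]
        push_cast
        ring

lemma MaximalSignBound.extrapolate_up {K : ℝ≥0} (h : MaximalSignBound X 1 K) {q : ℝ}
    (hq : 1 < q) : ∃ K' : ℝ≥0, MaximalSignBound X q K' := by
  obtain ⟨K', hK'⟩ := exists_lintegral_rpow_le_of_weak hq (2 + 2 * K)
  exact ⟨K', fun Ω m P hP ℱ d hd ε hε N => hK' Ω m P hP _ _
    (((hd.const_smul ε).measurable_maxPartialSum N).mono (ℱ.le N) le_rfl)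
    ((hd.measurable_maxPartialSum N).mono (ℱ.le N) le_rfl)
    fun l _ => h.weak hd hε N l⟩

end ExtrapolationUp

section TruncatedMoments

lemma lintegral_truncated_rpow_le (z : ℝ≥0) {p : ℝ} (hp : 1 < p) :
    ∫⁻ t in Set.Ioi (0 : ℝ), ((t.toNNReal ^ p)⁻¹ * min z (2 * t.toNNReal) ^ p : ℝ≥0) ≤
      ((2 ^ p + ((p - 1)⁻¹).toNNReal : ℝ≥0) : ℝ≥0∞) * z := by
  have hp0 : 0 < p := by linarith
  rcases eq_or_ne z 0 with rfl | hz
  · simp [NNReal.zero_rpow hp0.ne']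
  have hz0 : (0 : ℝ) < z := NNReal.coe_pos.2 (pos_iff_ne_zero.2 hz)
  rw [← Set.Ioc_union_Ioi_eq_Ioi z.coe_nonneg]
  refine (lintegral_union_le _ _ _).trans ?_
  rw [ENNReal.coe_add, add_mul]
  refine add_le_add ?_ ?_
  · calc ∫⁻ t in Set.Ioc (0 : ℝ) z, ((t.toNNReal ^ p)⁻¹ * min z (2 * t.toNNReal) ^ p : ℝ≥0)
        ≤ ∫⁻ _ in Set.Ioc (0 : ℝ) z, ((2 ^ p : ℝ≥0) : ℝ≥0∞) := by
          refine setLIntegral_mono' measurableSet_Ioc fun t ht => ?_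
          rw [ENNReal.coe_le_coe]
          have ht' : t.toNNReal ^ p ≠ 0 := by
            have : 0 < t.toNNReal := Real.toNNReal_pos.2 ht.1
            exact (NNReal.rpow_pos this).ne'
          calc (t.toNNReal ^ p)⁻¹ * min z (2 * t.toNNReal) ^ p
              ≤ (t.toNNReal ^ p)⁻¹ * (2 * t.toNNReal) ^ p := by
                gcongr
                exact min_le_right _ _
            _ = 2 ^ p := by
                rw [NNReal.mul_rpow, mul_comm, mul_assoc, mul_inv_cancel₀ ht', mul_one]
      _ = _ := by
          rw [setLIntegral_const, Real.volume_Ioc, sub_zero, ENNReal.ofReal_coe_nnreal]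
  · calc ∫⁻ t in Set.Ioi (z : ℝ), ((t.toNNReal ^ p)⁻¹ * min z (2 * t.toNNReal) ^ p : ℝ≥0)
        ≤ ∫⁻ t in Set.Ioi (z : ℝ), ((z ^ p : ℝ≥0) : ℝ≥0∞) * ENNReal.ofReal (t ^ (-p)) := by
          refine setLIntegral_mono' measurableSet_Ioi fun t ht => ?_
          have ht0 : 0 ≤ t := hz0.le.trans (le_of_lt ht)
          have : ENNReal.ofReal (t ^ (-p)) = ((t.toNNReal ^ (-p) : ℝ≥0) : ℝ≥0∞) := by
            rw [ENNReal.ofReal, Real.toNNReal_rpow_of_nonneg ht0]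
          rw [this, ← ENNReal.coe_mul, ENNReal.coe_le_coe, NNReal.rpow_neg, mul_comm]
          gcongr
          exact min_le_left _ _
      _ = ((z ^ p : ℝ≥0) : ℝ≥0∞) * ENNReal.ofReal (-(z : ℝ) ^ (-p + 1) / (-p + 1)) := by
          rw [lintegral_const_mul' _ _ (by finiteness),
            ← ofReal_integral_eq_lintegral_ofReal
              (integrableOn_Ioi_rpow_of_lt (by linarith) hz0)
              ((ae_restrict_iff' measurableSet_Ioi).2 (ae_of_all _ fun t ht =>
                Real.rpow_nonneg (hz0.le.trans (le_of_lt ht)) _)),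
            integral_Ioi_rpow_of_lt (by linarith) hz0]
      _ = (((p - 1)⁻¹).toNNReal : ℝ≥0∞) * z := by
          rw [← ENNReal.ofReal_coe_nnreal, ← ENNReal.ofReal_coe_nnreal (p := z),
            ← ENNReal.ofReal_coe_nnreal (p := ((p - 1)⁻¹).toNNReal),
            ← ENNReal.ofReal_mul (by positivity), ← ENNReal.ofReal_mul (by positivity)]
          congr 1
          have hp1 : 0 < p - 1 := by linarith
          rw [Real.coe_toNNReal _ (inv_nonneg.2 hp1.le), NNReal.coe_rpow,
            Real.rpow_add_one hz0.ne', Real.rpow_neg hz0.le]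
          have h1 : (z : ℝ) ^ p ≠ 0 := (Real.rpow_pos_of_pos hz0 p).ne'
          have h2 : -p + 1 ≠ 0 := by linarith
          have h3 : p - 1 ≠ 0 := hp1.ne'
          field_simp
          ring

lemma lintegral_le_of_truncated_weak {Ω : Type*} [MeasurableSpace Ω] {P : Measure Ω}
    [IsProbabilityMeasure P] {T Z : Ω → ℝ≥0} (hT : Measurable T) (hZ : Measurable Z)
    {p : ℝ} (hp : 1 < p) (K : ℝ≥0)
    (hw : ∀ l : ℝ≥0, 0 < l → P {ω | l < T ω} ≤ P {ω | l < Z ω} +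
      K * ((((l ^ p)⁻¹ : ℝ≥0) : ℝ≥0∞) * ∫⁻ ω, ((min (Z ω) (2 * l) ^ p : ℝ≥0) : ℝ≥0∞) ∂P)) :
    ∫⁻ ω, T ω ∂P ≤ ((1 + K * (2 ^ p + ((p - 1)⁻¹).toNNReal) : ℝ≥0) : ℝ≥0∞) * ∫⁻ ω, Z ω ∂P := by
  have cake : ∀ f : Ω → ℝ≥0, Measurable f →
      ∫⁻ ω, f ω ∂P = ∫⁻ t in Set.Ioi (0 : ℝ), P {ω | t.toNNReal < f ω} := fun f hf => by
    have h := lintegral_coe_rpow_eq_lintegral_meas_lt P hf one_pos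
    simp only [ENNReal.rpow_one, ENNReal.ofReal_one, one_mul, sub_self, Real.rpow_zero,
      mul_one] at h
    rw [h]
    refine setLIntegral_congr_fun measurableSet_Ioi fun t ht => ?_
    simp only [← Real.toNNReal_lt_iff_lt_coe (le_of_lt ht)]
  have hmeas : Measurable (Function.uncurry fun (t : ℝ) (ω : Ω) =>
      (((t.toNNReal ^ p)⁻¹ * min (Z ω) (2 * t.toNNReal) ^ p : ℝ≥0) : ℝ≥0∞)) := by
    unfold Function.uncurry
    fun_prop
  have hmZ : Measurable fun t : ℝ => P {ω | t.toNNReal < Z ω} :=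
    Antitone.measurable fun s t hst => measure_mono fun ω hω =>
      lt_of_le_of_lt (Real.toNNReal_le_toNNReal hst) hω
  calc ∫⁻ ω, T ω ∂P
      = ∫⁻ t in Set.Ioi (0 : ℝ), P {ω | t.toNNReal < T ω} := cake T hT
    _ ≤ ∫⁻ t in Set.Ioi (0 : ℝ), (P {ω | t.toNNReal < Z ω} + K * ∫⁻ ω,
        (((t.toNNReal ^ p)⁻¹ * min (Z ω) (2 * t.toNNReal) ^ p : ℝ≥0) : ℝ≥0∞) ∂P) := by
        refine setLIntegral_mono' measurableSet_Ioi fun t ht => ?_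
        refine (hw t.toNNReal (Real.toNNReal_pos.2 ht)).trans (le_of_eq ?_)
        rw [← lintegral_const_mul _ (by fun_prop)]
        simp only [ENNReal.coe_mul]
    _ = ∫⁻ ω, Z ω ∂P + K * ∫⁻ ω, (∫⁻ t in Set.Ioi (0 : ℝ),
        (((t.toNNReal ^ p)⁻¹ * min (Z ω) (2 * t.toNNReal) ^ p : ℝ≥0) : ℝ≥0∞)) ∂P := by
        rw [lintegral_add_left hmZ, ← cake Z hZ, lintegral_const_mul' _ _ ENNReal.coe_ne_top,
          lintegral_lintegral_swap hmeas.aemeasurable]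
    _ ≤ ∫⁻ ω, Z ω ∂P + K * ∫⁻ ω,
        ((2 ^ p + ((p - 1)⁻¹).toNNReal : ℝ≥0) : ℝ≥0∞) * Z ω ∂P := by
        gcongr with ω
        exact lintegral_truncated_rpow_le (Z ω) hp
    _ = _ := by
        rw [lintegral_const_mul _ (by fun_prop)]
        push_cast
        ring

end TruncatedMoments

section ExtrapolationDown

variable {X : Type*} [NormedAddCommGroup X] [NormedSpace ℝ X] [CompleteSpace X]

lemma MaximalSignBound.truncated_weak {p : ℝ} (hp : 1 < p) {K : ℝ≥0} (h : MaximalSignBound X p K)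
    {Ω : Type} {m : MeasurableSpace Ω} {P : Measure Ω} [IsProbabilityMeasure P]
    {ℱ : Filtration ℕ m} {u : ℕ → Ω → X} (hu : IsIncrementSeq ℱ P u) {J : ℕ → Ω → ℝ≥0}
    (hJm : ∀ n, Measurable[ℱ n] (J n)) (hJ : Monotone J) (huJ : ∀ᵐ ω ∂P, ∀ n, ‖u n ω‖₊ ≤ J n ω)
    {ε : ℕ → ℝ} (hε : ∀ j, ε j = 1 ∨ ε j = -1) (N : ℕ) (l : ℝ≥0) (hl : 0 < l) :
    P {ω | l < maxPartialSum (fun j => ε j • u j ω) N} ≤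
      P {ω | l < max (maxPartialSum (fun j => u j ω) N) (J N ω)} +
      K * ((((l ^ p)⁻¹ : ℝ≥0) : ℝ≥0∞) * ∫⁻ ω, ((min (max (maxPartialSum (fun j => u j ω) N)
        (J N ω)) (2 * l) ^ p : ℝ≥0) : ℝ≥0∞) ∂P) := by
  have hp0 : 0 < p := by linarith
  set Z : ℕ → Ω → ℝ≥0 := fun n ω => max (maxPartialSum (fun j => u j ω) n) (J n ω)
  have hZmono : Monotone Z := fun i j hij ω =>
    max_le_max (maxPartialSum_mono _ hij) (hJ hij ω)
  have hZm : ∀ n, Measurable[ℱ n] (Z n) := fun n => (hu.measurable_maxPartialSum n).max (hJm n)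
  set B : ℕ → Set Ω := fun n => {ω | Z n ω ≤ l}
  have hBanti : Antitone B := fun i j hij ω hω => (hZmono hij ω).trans hω
  have hBm : ∀ n, MeasurableSet[ℱ n] (B n) := fun n => hZm n measurableSet_Iic
  set w : ℕ → Ω → X := fun n => (B n).indicator (u n) with hw
  have hdw : IsIncrementSeq ℱ P w := hu.indicator hBm
  have hbound := h Ω m P inferInstance ℱ w hdw ε hε N
  have hw_le : ∀ᵐ ω ∂P, (maxPartialSum (fun n => w n ω) N : ℝ≥0∞) ^ p ≤
      ((min (Z N ω) (2 * l) ^ p : ℝ≥0) : ℝ≥0∞) := by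
    filter_upwards [huJ] with ω hω
    rw [← ENNReal.coe_rpow_of_nonneg _ hp0.le, ENNReal.coe_le_coe]
    refine NNReal.rpow_le_rpow (maxPartialSum_le_iff.2 fun k hk => ?_) hp0.le
    obtain ⟨j, hj, hj', hjB⟩ := exists_sum_indicator_eq u hBanti ω k
    rw [show ∑ n ∈ Finset.range k, w n ω = _ from hj']
    refine le_min ((nnnorm_sum_le_maxPartialSum (fun j => u j ω) (hj.trans hk)).trans
      (le_max_left _ _)) ?_
    rcases j with - | i
    · simp
    · rw [Finset.sum_range_succ, two_mul]
      have hi : Z i ω ≤ l := hjB i i.lt_succ_self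
      refine (nnnorm_add_le _ _).trans (add_le_add ?_ ?_)
      · exact (nnnorm_sum_le_maxPartialSum (fun j => u j ω) le_rfl).trans
          ((le_max_left _ _).trans hi)
      · exact (hω i).trans ((le_max_right _ _).trans hi)
  have hsub : {ω | l < maxPartialSum (fun j => ε j • u j ω) N} ⊆ {ω | l < Z N ω} ∪
      {ω | ((l ^ p : ℝ≥0) : ℝ≥0∞) ≤ (maxPartialSum (fun j => ε j • w j ω) N : ℝ≥0∞) ^ p} := by
    intro ω hω
    by_cases hZl : l < Z N ω
    · exact Or.inl hZl
    · refine Or.inr ?_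
      have e : maxPartialSum (fun j => ε j • w j ω) N = maxPartialSum (fun j => ε j • u j ω) N := by
        refine Finset.sup_congr rfl fun k hk => ?_
        congr 1
        refine Finset.sum_congr rfl fun n hn => ?_
        have hmem : ω ∈ B n := (hZmono ((Finset.mem_range.1 hn).le.trans
          (Nat.lt_succ_iff.1 (Finset.mem_range.1 hk))) ω).trans (not_lt.1 hZl)
        simp only [hw, Set.indicator_of_mem hmem]
      rw [Set.mem_ofPred_eq, e, ← ENNReal.coe_rpow_of_nonneg _ hp0.le, ENNReal.coe_le_coe]
      exact NNReal.rpow_le_rpow (le_of_lt hω) hp0.le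
  refine (measure_mono hsub).trans ((measure_union_le _ _).trans (add_le_add le_rfl ?_))
  have hmk := mul_meas_ge_le_lintegral₀ (μ := P)
    (f := fun ω => (maxPartialSum (fun j => ε j • w j ω) N : ℝ≥0∞) ^ p)
    (((((hdw.const_smul ε).measurable_maxPartialSum N).mono (ℱ.le N)
      le_rfl).coe_nnreal_ennreal.pow_const p).aemeasurable) ((l ^ p : ℝ≥0) : ℝ≥0∞)
  have hlp : l ^ p ≠ 0 := (NNReal.rpow_pos hl).ne'
  rw [mul_left_comm, ENNReal.coe_inv hlp, ← ENNReal.div_eq_inv_mul,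
    ENNReal.le_div_iff_mul_le (by simp [hlp]) (by simp), mul_comm]
  refine hmk.trans (hbound.trans ?_)
  exact mul_le_mul_right (lintegral_mono_ae hw_le) _

end ExtrapolationDown

section DavisDecomposition

/-- The largest norm among the first `n` increments. -/
def maxIncrement {X : Type*} [NormedAddCommGroup X] (d : ℕ → X) (n : ℕ) : ℝ≥0 :=
  (Finset.range n).sup fun j => ‖d j‖₊

lemma maxIncrement_mono {X : Type*} [NormedAddCommGroup X] (d : ℕ → X) :
    Monotone (maxIncrement d) := fun _ _ h =>
  Finset.sup_mono (Finset.range_subset_range.2 h)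

lemma maxIncrement_succ {X : Type*} [NormedAddCommGroup X] (d : ℕ → X) (n : ℕ) :
    maxIncrement d (n + 1) = max ‖d n‖₊ (maxIncrement d n) := by
  simp [maxIncrement, Finset.range_add_one]

lemma maxIncrement_le_two_mul_maxPartialSum {X : Type*} [NormedAddCommGroup X]
    (d : ℕ → X) (n : ℕ) : maxIncrement d n ≤ 2 * maxPartialSum d n :=
  Finset.sup_le fun _ hj => nnnorm_le_two_mul_maxPartialSum d (Finset.mem_range.1 hj)

lemma sum_large_increment_le {X : Type*} [NormedAddCommGroup X] (d : ℕ → X) (n : ℕ) :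
    ∑ j ∈ Finset.range n, (if ‖d j‖₊ ≤ 2 * maxIncrement d j then 0 else ‖d j‖₊) ≤
      2 * maxIncrement d n := by
  induction n with
  | zero => simp
  | succ n ih =>
    rw [Finset.sum_range_succ]
    split_ifs with hn
    · rw [add_zero]
      exact ih.trans (mul_le_mul_right (maxIncrement_mono d n.le_succ) _)
    · calc _ ≤ 2 * maxIncrement d n + ‖d n‖₊ := add_le_add ih le_rfl
        _ ≤ ‖d n‖₊ + ‖d n‖₊ := add_le_add (not_le.1 hn).le le_rfl
        _ = 2 * ‖d n‖₊ := (two_mul _).symm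
        _ ≤ _ := by
          rw [maxIncrement_succ]
          exact mul_le_mul_right (le_max_left _ _) _

variable {Ω X : Type*} [NormedAddCommGroup X] [NormedSpace ℝ X]
  {m : MeasurableSpace Ω} {ℱ : Filtration ℕ m} {P : Measure Ω} {d : ℕ → Ω → X}

lemma IsIncrementSeq.measurable_maxIncrement (hd : IsIncrementSeq ℱ P d) (n : ℕ) :
    Measurable[ℱ n] (fun ω => maxIncrement (fun j => d j ω) n) :=
  measurable_finset_sup_nnreal fun _ hk =>
    (hd.stronglyMeasurable_of_lt (Finset.mem_range.1 hk)).nnnorm.measurable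

lemma IsIncrementSeq.integrable_maxIncrement (hd : IsIncrementSeq ℱ P d) (n : ℕ) :
    Integrable (fun ω => (maxIncrement (fun j => d j ω) n : ℝ)) P := by
  refine Integrable.mono' (g := fun ω => ∑ j ∈ Finset.range n, ‖d j ω‖)
    (integrable_finsetSum _ fun j _ => (hd.integrable j).norm)
    ((hd.measurable_maxIncrement n).mono (ℱ.le n)
      le_rfl).coe_nnreal_real.aestronglyMeasurable (ae_of_all _ fun ω => ?_)
  rw [Real.norm_of_nonneg (NNReal.coe_nonneg _)]
  have : maxIncrement (fun j => d j ω) n ≤ ∑ j ∈ Finset.range n, ‖d j ω‖₊ :=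
    Finset.sup_le fun j hj => Finset.single_le_sum_of_canonicallyOrdered
      (f := fun j => ‖d j ω‖₊) hj
  exact (NNReal.coe_le_coe.2 this).trans_eq (by simp)

variable [CompleteSpace X]

lemma nnnorm_condExp_le_of_nnnorm_le {m' : MeasurableSpace Ω} (hm : m' ≤ m)
    [IsProbabilityMeasure P] {f : Ω → X} (hf : Integrable f P) {g : Ω → ℝ≥0}
    (hg : Measurable[m'] g) (hgi : Integrable (fun ω => (g ω : ℝ)) P)
    (hfg : ∀ ω, ‖f ω‖₊ ≤ g ω) : ∀ᵐ ω ∂P, ‖(P[f | m']) ω‖₊ ≤ g ω := by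
  have h1 := condExp_mono (m := m') (μ := P) hf.norm hgi (ae_of_all _ fun ω => hfg ω)
  rw [condExp_of_stronglyMeasurable hm hg.coe_nnreal_real.stronglyMeasurable hgi] at h1
  filter_upwards [norm_condExp_le (μ := P) (m := m') f, h1] with ω h2 h3
  exact NNReal.coe_le_coe.1 (h2.trans h3)

lemma lintegral_nnnorm_condExp_le {m' : MeasurableSpace Ω} {f : Ω → X} :
    ∫⁻ ω, ‖(P[f | m']) ω‖₊ ∂P ≤ ∫⁻ ω, ‖f ω‖₊ ∂P := by
  have := eLpNorm_condExp_le_eLpNorm (m := m') (μ := P) f le_rfl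
  rwa [eLpNorm_one_eq_lintegral_enorm, eLpNorm_one_eq_lintegral_enorm] at this

/-- Davis' decomposition of a martingale difference sequence into a part whose jumps are
controlled by the past and a part of integrable variation. -/
lemma IsIncrementSeq.exists_davis_decomposition [IsProbabilityMeasure P]
    (hd : IsIncrementSeq ℱ P d) : ∃ u v : ℕ → Ω → X, IsIncrementSeq ℱ P u ∧
      (∀ n, StronglyMeasurable (v n)) ∧ (∀ n ω, d n ω = u n ω + v n ω) ∧
      (∀ᵐ ω ∂P, ∀ n, ‖u n ω‖₊ ≤ 4 * maxIncrement (fun j => d j ω) n) ∧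
      ∀ N, ∫⁻ ω, ((∑ n ∈ Finset.range N, ‖v n ω‖₊ : ℝ≥0) : ℝ≥0∞) ∂P ≤
        4 * ∫⁻ ω, maxIncrement (fun j => d j ω) N ∂P := by
  set D : ℕ → Ω → ℝ≥0 := fun n ω => maxIncrement (fun j => d j ω) n with hD
  have hDm : ∀ n, Measurable[ℱ n] (D n) := hd.measurable_maxIncrement
  set A : ℕ → Set Ω := fun n => {ω | ‖d n ω‖₊ ≤ 2 * D n ω}
  have hAm : ∀ n, MeasurableSet[ℱ (n + 1)] (A n) := fun n =>
    measurableSet_le (hd.stronglyMeasurable n).nnnorm.measurable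
      (((hDm n).mono (ℱ.mono n.le_succ) le_rfl).const_mul 2)
  set a : ℕ → Ω → X := fun n => (A n).indicator (d n) with ha
  set b : ℕ → Ω → X := fun n => ((A n)ᶜ).indicator (d n)
  have hab : ∀ n, a n + b n = d n := fun n => Set.indicator_self_add_compl _ _
  have haM : ∀ n, StronglyMeasurable[ℱ (n + 1)] (a n) := fun n =>
    (hd.stronglyMeasurable n).indicator (hAm n)
  have hbM : ∀ n, StronglyMeasurable[ℱ (n + 1)] (b n) := fun n =>
    (hd.stronglyMeasurable n).indicator (hAm n).compl
  have haI : ∀ n, Integrable (a n) P := fun n =>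
    (hd.integrable n).indicator (ℱ.le _ _ (hAm n))
  have hbI : ∀ n, Integrable (b n) P := fun n =>
    (hd.integrable n).indicator (ℱ.le _ _ (hAm n).compl)
  have ha_le : ∀ n ω, ‖a n ω‖₊ ≤ 2 * D n ω := fun n ω => by
    by_cases hω : ω ∈ A n
    · rw [show a n ω = d n ω from Set.indicator_of_mem hω _]
      exact hω
    · simp [ha, hω]
  have hcab : ∀ n, ∀ᵐ ω ∂P, ‖(P[a n | ℱ n]) ω‖₊ = ‖(P[b n | ℱ n]) ω‖₊ := fun n => by
    have h1 := condExp_add (haI n) (hbI n) (ℱ n)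
    rw [hab n] at h1
    filter_upwards [h1, hd.condExp_eq_zero n] with ω h2 h3
    rw [h3, Pi.zero_apply, Pi.add_apply] at h2
    rw [eq_neg_of_add_eq_zero_left h2.symm, nnnorm_neg]
  have hb_sum : ∀ N ω, ∑ n ∈ Finset.range N, ‖b n ω‖₊ ≤ 2 * D N ω := fun N ω => by
    refine le_trans (le_of_eq (Finset.sum_congr rfl fun n _ => ?_))
      (sum_large_increment_le (fun j => d j ω) N)
    by_cases hω : ‖d n ω‖₊ ≤ 2 * D n ω
    · rw [if_pos hω, nnnorm_eq_zero]
      exact Set.indicator_of_notMem (s := (A n)ᶜ)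
        (Set.notMem_compl_iff.2 (show ω ∈ A n from hω)) _
    · rw [if_neg hω]
      exact congrArg _ (Set.indicator_of_mem (show ω ∈ (A n)ᶜ from hω) _)
  have hcM : ∀ n, StronglyMeasurable[ℱ n] (P[a n | ℱ n]) := fun n => stronglyMeasurable_condExp
  refine ⟨fun n => a n - P[a n | ℱ n], fun n => b n + P[a n | ℱ n], ⟨fun n => ?_, fun n => ?_,
    fun n => ?_⟩, fun n => ?_, fun n ω => ?_, ?_, fun N => ?_⟩
  · exact (haM n).sub ((hcM n).mono (ℱ.mono n.le_succ))
  · exact (haI n).sub integrable_condExp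
  · refine (condExp_sub (haI n) integrable_condExp (ℱ n)).trans ?_
    rw [condExp_of_stronglyMeasurable (ℱ.le n) (hcM n) integrable_condExp, sub_self]
  · exact ((hbM n).mono (ℱ.le _)).add ((hcM n).mono (ℱ.le _))
  · rw [← hab n]
    simp only [Pi.add_apply, Pi.sub_apply]
    abel
  · refine ae_all_iff.2 fun n => ?_
    filter_upwards [nnnorm_condExp_le_of_nnnorm_le (ℱ.le n) (haI n) ((hDm n).const_mul 2)
      (by simpa using (hd.integrable_maxIncrement n).const_mul 2) (ha_le n)] with ω hω
    refine (nnnorm_sub_le _ _).trans ((add_le_add (ha_le n ω) hω).trans (le_of_eq ?_))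
    simp only [hD]
    ring
  · have hbm : ∀ n, Measurable fun ω => (‖b n ω‖₊ : ℝ≥0∞) := fun n =>
      ((hbM n).mono (ℱ.le _)).nnnorm.measurable.coe_nnreal_ennreal
    calc ∫⁻ ω, ((∑ n ∈ Finset.range N, ‖(b n + P[a n | ℱ n]) ω‖₊ : ℝ≥0) : ℝ≥0∞) ∂P
        ≤ ∫⁻ ω, ∑ n ∈ Finset.range N,
            ((‖b n ω‖₊ : ℝ≥0∞) + (‖(P[a n | ℱ n]) ω‖₊ : ℝ≥0∞)) ∂P := by
          refine lintegral_mono_fn' le_rfl fun ω => ?_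
          rw [ENNReal.ofNNReal_finsetSum]
          exact Finset.sum_le_sum fun n _ => by exact_mod_cast nnnorm_add_le _ _
      _ = ∑ n ∈ Finset.range N, (∫⁻ ω, ‖b n ω‖₊ ∂P + ∫⁻ ω, ‖(P[a n | ℱ n]) ω‖₊ ∂P) := by
          rw [lintegral_finsetSum _ fun n _ => by
            exact (hbm n).add ((hcM n).mono (ℱ.le _)).nnnorm.measurable.coe_nnreal_ennreal]
          exact Finset.sum_congr rfl fun n _ => lintegral_add_left (hbm n) _
      _ ≤ ∑ n ∈ Finset.range N, (∫⁻ ω, ‖b n ω‖₊ ∂P + ∫⁻ ω, ‖b n ω‖₊ ∂P) := by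
          refine Finset.sum_le_sum fun n _ => add_le_add le_rfl ?_
          rw [lintegral_congr_ae ((hcab n).mono fun ω h => congrArg ENNReal.ofNNReal h)]
          exact lintegral_nnnorm_condExp_le
      _ = 2 * ∫⁻ ω, ((∑ n ∈ Finset.range N, ‖b n ω‖₊ : ℝ≥0) : ℝ≥0∞) ∂P := by
          simp_rw [ENNReal.ofNNReal_finsetSum, ← two_mul]
          rw [← Finset.mul_sum, lintegral_finsetSum _ fun n _ => hbm n]
      _ ≤ 2 * ∫⁻ ω, 2 * (D N ω : ℝ≥0∞) ∂P := by
          refine mul_le_mul_right (lintegral_mono_fn' le_rfl fun ω => ?_) _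
          exact_mod_cast hb_sum N ω
      _ = 4 * ∫⁻ ω, D N ω ∂P := by
          rw [lintegral_const_mul' _ _ ENNReal.ofNat_ne_top, ← mul_assoc]
          norm_num

end DavisDecomposition

lemma MaximalSignBound.extrapolate_down {X : Type*} [NormedAddCommGroup X] [NormedSpace ℝ X]
    [CompleteSpace X] {p : ℝ} (hp : 1 < p) {K : ℝ≥0} (h : MaximalSignBound X p K) :
    ∃ K' : ℝ≥0, MaximalSignBound X 1 K' := by
  set C : ℝ≥0 := 1 + K * (2 ^ p + ((p - 1)⁻¹).toNNReal)
  refine ⟨C * 17 + 8, fun Ω m P hP ℱ d hd ε hε N => ?_⟩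
  obtain ⟨u, v, hu, hv, hduv, huJ, hvD⟩ := hd.exists_davis_decomposition
  simp_rw [ENNReal.rpow_one]
  set F : Ω → ℝ≥0 := fun ω => maxPartialSum (fun n => d n ω) N
  set D : Ω → ℝ≥0 := fun ω => maxIncrement (fun n => d n ω) N
  set V : Ω → ℝ≥0 := fun ω => ∑ n ∈ Finset.range N, ‖v n ω‖₊
  set U : Ω → ℝ≥0 := fun ω => maxPartialSum (fun n => u n ω) N
  have hFm : Measurable F := (hd.measurable_maxPartialSum N).mono (ℱ.le N) le_rfl
  have hUm : Measurable U := (hu.measurable_maxPartialSum N).mono (ℱ.le N) le_rfl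
  have hDm : Measurable D := (hd.measurable_maxIncrement N).mono (ℱ.le N) le_rfl
  have hTm : Measurable fun ω => maxPartialSum (fun n => ε n • u n ω) N :=
    ((hu.const_smul ε).measurable_maxPartialSum N).mono (ℱ.le N) le_rfl
  have hDF : ∀ ω, D ω ≤ 2 * F ω := fun ω => maxIncrement_le_two_mul_maxPartialSum _ N
  have hVF : ∫⁻ ω, V ω ∂P ≤ 8 * ∫⁻ ω, F ω ∂P := by
    calc ∫⁻ ω, V ω ∂P ≤ 4 * ∫⁻ ω, D ω ∂P := hvD N
      _ ≤ 4 * ∫⁻ ω, 2 * (F ω : ℝ≥0∞) ∂P := by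
          refine mul_le_mul_right (lintegral_mono_fn' le_rfl fun ω => ?_) _
          exact_mod_cast hDF ω
      _ = _ := by
          rw [lintegral_const_mul' _ _ ENNReal.ofNat_ne_top, ← mul_assoc]
          norm_num
  have hUF : ∀ ω, U ω ≤ F ω + V ω := fun ω => by
    have e : (fun n => u n ω) = fun n => d n ω + -v n ω := by
      ext n; rw [hduv n ω]; abel
    have := (maxPartialSum_add_le (fun n => d n ω) (fun n => -v n ω) N).trans
      (add_le_add le_rfl (maxPartialSum_le_sum _ N))
    simpa only [← e, nnnorm_neg] using this
  have hdu : ∀ ω, maxPartialSum (fun n => ε n • d n ω) N ≤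
      maxPartialSum (fun n => ε n • u n ω) N + V ω := fun ω => by
    have e : (fun n => ε n • d n ω) = fun n => ε n • u n ω + ε n • v n ω := by
      ext n; rw [hduv n ω, smul_add]
    have := (maxPartialSum_add_le (fun n => ε n • u n ω) (fun n => ε n • v n ω) N).trans
      (add_le_add le_rfl (maxPartialSum_le_sum _ N))
    simpa only [← e, nnnorm_sign_smul (hε _)] using this
  have hweak := lintegral_le_of_truncated_weak hTm (hUm.max (hDm.const_mul 4)) hp K
    fun l hl => h.truncated_weak hp hu (J := fun n ω => 4 * maxIncrement (fun j => d j ω) n)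
      (fun n => (hd.measurable_maxIncrement n).const_mul 4)
      (fun i j hij ω => mul_le_mul_right (maxIncrement_mono _ hij) _) huJ hε N l hl
  have hmax : ∫⁻ ω, ((max (U ω) (4 * D ω) : ℝ≥0) : ℝ≥0∞) ∂P ≤ 17 * ∫⁻ ω, F ω ∂P := by
    calc ∫⁻ ω, ((max (U ω) (4 * D ω) : ℝ≥0) : ℝ≥0∞) ∂P
        ≤ ∫⁻ ω, (9 * (F ω : ℝ≥0∞) + V ω) ∂P := by
          refine lintegral_mono_fn' le_rfl fun ω => ?_
          have : max (U ω) (4 * D ω) ≤ 9 * F ω + V ω := by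
            have h1 := hUF ω
            have h2 := hDF ω
            have h3 : (0 : ℝ≥0) ≤ V ω := zero_le
            have h4 : (0 : ℝ≥0) ≤ F ω := zero_le
            refine max_le ?_ ?_ <;> linarith
          exact_mod_cast this
      _ = 9 * ∫⁻ ω, F ω ∂P + ∫⁻ ω, V ω ∂P := by
          rw [lintegral_add_left (by fun_prop), lintegral_const_mul' _ _ ENNReal.ofNat_ne_top]
      _ ≤ 9 * ∫⁻ ω, F ω ∂P + 8 * ∫⁻ ω, F ω ∂P := add_le_add le_rfl hVF
      _ = _ := by
          rw [← add_mul]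
          norm_num
  calc ∫⁻ ω, (maxPartialSum (fun n => ε n • d n ω) N : ℝ≥0∞) ∂P
      ≤ ∫⁻ ω, ((maxPartialSum (fun n => ε n • u n ω) N : ℝ≥0∞) + V ω) ∂P :=
        lintegral_mono_fn' le_rfl fun ω => by exact_mod_cast hdu ω
    _ = ∫⁻ ω, maxPartialSum (fun n => ε n • u n ω) N ∂P + ∫⁻ ω, V ω ∂P :=
        lintegral_add_left hTm.coe_nnreal_ennreal _
    _ ≤ C * (17 * ∫⁻ ω, F ω ∂P) + 8 * ∫⁻ ω, F ω ∂P :=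
        add_le_add (hweak.trans (mul_le_mul_right hmax _)) hVF
    _ = _ := by
        push_cast
        ring

lemma MaximalSignBound.isUMD {X : Type*} [NormedAddCommGroup X] [NormedSpace ℝ X]
    [CompleteSpace X] {K : ℝ≥0} (h : MaximalSignBound X 1 K) : IsUMD X := by
  intro q hq
  have hq0 : 0 < q := by linarith
  obtain ⟨K₁, hK₁⟩ := h.extrapolate_up hq
  obtain ⟨K₂, hK₂⟩ := exists_doob_maximal X hq
  refine ⟨((K₁ * K₂) ^ (1 / q) + 1 : ℝ≥0), by positivity, fun Ω m P hP ℱ d hd ε hε n => ?_⟩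
  have hd' := IsIncrementSeq.of_isMartDiffSeq hd
  have key : ∫⁻ ω, (‖∑ j ∈ Finset.range n, ε j • d j ω‖₊ : ℝ≥0∞) ^ q ∂P ≤
      ((K₁ * K₂ : ℝ≥0) : ℝ≥0∞) *
        ∫⁻ ω, (‖∑ j ∈ Finset.range n, d j ω‖₊ : ℝ≥0∞) ^ q ∂P := by
    refine le_trans (lintegral_mono_fn' le_rfl fun ω => ENNReal.rpow_le_rpow (ENNReal.coe_le_coe.2
      (nnnorm_sum_le_maxPartialSum (fun j => ε j • d j ω) le_rfl)) hq0.le) ?_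
    refine (hK₁ Ω m P hP ℱ d hd' ε hε n).trans ?_
    rw [ENNReal.coe_mul, mul_assoc]
    exact mul_le_mul_right (hK₂ Ω m P hP ℱ d hd' n) _
  refine (ENNReal.rpow_le_rpow key (one_div_nonneg.2 hq0.le)).trans ?_
  rw [ENNReal.mul_rpow_of_nonneg _ _ (one_div_nonneg.2 hq0.le), ENNReal.ofReal_coe_nnreal,
    ← ENNReal.coe_rpow_of_nonneg _ (one_div_nonneg.2 hq0.le)]
  gcongr
  exact le_add_right le_rfl

/-- **Necessity of UMD for the discrete BDG inequalities** (Theorem 2.4).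
Let `X` be a Banach space and `1 ≤ p < ∞` be such that the two-sided estimate
`E sup_m ‖Σ_{n≤m} d_n‖^p ≍ E ‖(d_n)‖_{γ(ℓ²,X)}^p` holds, with constants independent of the
martingale, for every `X`-valued martingale difference sequence. Then `X` is UMD. -/
theorem umd_of_bdg_discrete
    (X : Type*) [NormedAddCommGroup X] [NormedSpace ℝ X] [CompleteSpace X]
    (p : ℝ) (hp : 1 ≤ p) (c C : ℝ) (hc : 0 < c) (hC : 0 < C)
    (h : ∀ (Ω : Type) (m : MeasurableSpace Ω) (P : Measure Ω), IsProbabilityMeasure P →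
      ∀ (ℱ : Filtration ℕ m) (d : ℕ → Ω → X), IsMartDiffSeq ℱ P d →
        ENNReal.ofReal c * ∫⁻ ω, gammaSeqNorm (fun n => d n ω) ^ p ∂P ≤
            ∫⁻ ω, (⨆ M : ℕ, (‖∑ n ∈ Finset.range M, d n ω‖₊ : ℝ≥0∞)) ^ p ∂P ∧
        (∫⁻ ω, (⨆ M : ℕ, (‖∑ n ∈ Finset.range M, d n ω‖₊ : ℝ≥0∞)) ^ p ∂P) ≤
            ENNReal.ofReal C * ∫⁻ ω, gammaSeqNorm (fun n => d n ω) ^ p ∂P) :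
    IsUMD X := by
  have hK := maximalSignBound_of_bdg X p c C hc h
  rcases hp.eq_or_lt with rfl | hp
  · exact hK.isUMD
  · obtain ⟨K, hK⟩ := hK.extrapolate_down hp
    exact hK.isUMD

end
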